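/- For 0 < α ≤ 1 and γ > 0, the function y(t) := E_α(-γ t^α) defined for t ≥ 0 is nonincreasing on [0,∞). -/

import Mathlib

/-- The Mittag-Leffler function `E_α(t) = ∑ t^j / Γ(jα+1)`. -/
noncomputable def mittagLeffler (α : ℝ) (t : ℝ) : ℝ :=
  ∑' j : ℕ, t ^ j / Real.Gamma (j * α + 1)

open Filter Topology Finset

/-- The coefficient of `z ^ n` in `(1 - z) ^ (-β)`. -/
noncomputable def binomialNegCoeff (β : ℝ) (n : ℕ) : ℝ :=
  ∏ k ∈ range n, (β + k) / (k + 1)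

theorem binomialNegCoeff_zero_right (β : ℝ) : binomialNegCoeff β 0 = 1 := by
  simp [binomialNegCoeff]

theorem binomialNegCoeff_succ (β : ℝ) (n : ℕ) :
    binomialNegCoeff β (n + 1) = binomialNegCoeff β n * ((β + n) / (n + 1)) :=
  prod_range_succ _ _

theorem binomialNegCoeff_nonneg {β : ℝ} (hβ : 0 ≤ β) (n : ℕ) : 0 ≤ binomialNegCoeff β n :=
  prod_nonneg fun _ _ => by positivity

theorem binomialNegCoeff_neg_nonpos {α : ℝ} (hα : 0 ≤ α) (hα1 : α ≤ 1) {n : ℕ} (hn : n ≠ 0) :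
    binomialNegCoeff (-α) n ≤ 0 := by
  obtain ⟨m, rfl⟩ := Nat.exists_eq_succ_of_ne_zero hn
  rw [binomialNegCoeff, Nat.succ_eq_add_one, prod_range_succ']
  refine mul_nonpos_of_nonneg_of_nonpos (prod_nonneg fun k _ => ?_) (by simpa using hα)
  have : (0 : ℝ) ≤ k := k.cast_nonneg
  push_cast
  exact div_nonneg (by linarith) (by positivity)

theorem binomialNegCoeff_eq_choose (β : ℝ) (n : ℕ) :
    binomialNegCoeff β n = (-1) ^ n * Ring.choose (-β) n := by
  induction n with
  | zero => simp [binomialNegCoeff]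
  | succ n ih =>
    rw [binomialNegCoeff_succ, ih, Ring.choose_eq_smul, Ring.choose_eq_smul,
      descPochhammer_succ_right, Polynomial.smeval_mul, Nat.factorial_succ]
    have : (n : ℝ) + 1 ≠ 0 := by positivity
    have : (n.factorial : ℝ) ≠ 0 := by positivity
    simp [Polynomial.smeval_sub, Polynomial.smeval_X, Polynomial.smeval_natCast, pow_succ]
    field_simp
    ring

/-- The power series of `(1 - z) ^ (-β)`. -/
noncomputable def binomialNegSeries (β : ℝ) : PowerSeries ℝ := PowerSeries.mk (binomialNegCoeff β)

theorem binomialNegSeries_mul (β δ : ℝ) :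
    binomialNegSeries β * binomialNegSeries δ = binomialNegSeries (β + δ) := by
  have h (β : ℝ) : binomialNegSeries β =
      PowerSeries.rescale (-1 : ℝ) (PowerSeries.binomialSeries ℝ (-β)) := by
    ext n
    simp [binomialNegSeries, PowerSeries.coeff_rescale, binomialNegCoeff_eq_choose]
  rw [h, h, h, ← map_mul, ← PowerSeries.binomialSeries_add, neg_add]

theorem PowerSeries.coeff_nonneg_of_mul {U V : PowerSeries ℝ} (h0 : 0 < coeff 0 U)
    (hU : ∀ n ≠ 0, coeff n U ≤ 0) (hUV : ∀ n, 0 ≤ coeff n (V * U)) (n : ℕ) : 0 ≤ coeff n V := by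
  induction n using Nat.strong_induction_on with
  | _ n ih =>
    have h := hUV n
    rw [coeff_mul, Nat.sum_antidiagonal_eq_sum_range_succ (fun i j => coeff i V * coeff j U),
      sum_range_succ, Nat.sub_self] at h
    have hs : ∑ k ∈ range n, coeff k V * coeff (n - k) U ≤ 0 :=
      sum_nonpos fun k hk => mul_nonpos_of_nonneg_of_nonpos (ih k (mem_range.1 hk))
        (hU _ (Nat.sub_ne_zero_of_lt (mem_range.1 hk)))
    exact nonneg_of_mul_nonneg_left (by linarith) h0

theorem binomialNegCoeff_le_pow {β : ℝ} (hβ : 0 ≤ β) (n : ℕ) :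
    binomialNegCoeff (β + 1) n ≤ (1 + β) ^ n := by
  refine (prod_le_prod (fun _ _ => by positivity) fun k _ => ?_).trans_eq
    (by rw [prod_const, card_range])
  rw [div_le_iff₀ (by positivity)]
  nlinarith [mul_nonneg hβ k.cast_nonneg, (k.cast_nonneg : (0:ℝ) ≤ k)]

theorem one_add_div_le_rpow {β : ℝ} (hβ : 0 ≤ β) {n : ℝ} (hn : 0 < n) :
    1 + β / (n + 1) ≤ ((n + 1) / n) ^ β := by
  have h : 1 / (n + 1) ≤ Real.log ((n + 1) / n) := by
    have := Real.one_sub_inv_le_log_of_pos (x := (n + 1) / n) (by positivity)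
    refine le_trans (le_of_eq ?_) this
    field_simp
    ring
  rw [Real.rpow_def_of_pos (by positivity)]
  calc 1 + β / (n + 1) ≤ Real.exp (β / (n + 1)) := by linarith [Real.add_one_le_exp (β / (n + 1))]
    _ ≤ _ := Real.exp_le_exp.2 (by
      rw [div_eq_mul_one_div, mul_comm]; exact mul_le_mul_of_nonneg_right h hβ)

theorem binomialNegCoeff_le_rpow {β : ℝ} (hβ : 0 ≤ β) {K n : ℕ} (hK : 0 < K) (hn : K ≤ n) :
    binomialNegCoeff (β + 1) n ≤ (1 + β) ^ K * (n / K : ℝ) ^ β := by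
  induction n, hn using Nat.le_induction with
  | base =>
    have : (K : ℝ) ≠ 0 := by positivity
    simpa [this] using binomialNegCoeff_le_pow hβ K
  | succ n hn ih =>
    have hn0 : (0 : ℝ) < n := by exact_mod_cast hK.trans_le hn
    have hK0 : (0 : ℝ) < K := by exact_mod_cast hK
    rw [binomialNegCoeff_succ]
    have e : (β + 1 + n) / (n + 1) = 1 + β / (n + 1) := by field_simp; ring
    rw [e]
    refine (mul_le_mul ih (one_add_div_le_rpow hβ hn0) (by positivity) (by positivity)).trans_eq ?_
    rw [mul_assoc, ← Real.mul_rpow (by positivity) (by positivity)]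
    congr 2
    push_cast
    field_simp

theorem tendsto_binomialNegCoeff_div_rpow {β : ℝ} (hβ : 0 ≤ β) :
    Tendsto (fun n : ℕ => binomialNegCoeff (β + 1) n / (n : ℝ) ^ β) atTop
      (𝓝 (Real.Gamma (β + 1))⁻¹) := by
  rcases hβ.eq_or_lt with rfl | hβ
  · have (n : ℕ) : binomialNegCoeff 1 n = 1 :=
      prod_eq_one fun k _ => by rw [add_comm, div_self]; positivity
    simp [this]
  · rw [Real.Gamma_add_one hβ.ne']
    refine (((Real.GammaSeq_tendsto_Gamma β).const_mul β).inv₀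
      (mul_pos hβ (Real.Gamma_pos_of_pos hβ)).ne').congr fun n => ?_
    have h : binomialNegCoeff (β + 1) n = (∏ j ∈ range n, (β + 1 + j)) / n.factorial := by
      rw [binomialNegCoeff, prod_div_distrib, ← prod_range_add_one_eq_factorial]
      push_cast; rfl
    have hp : ∏ j ∈ range n, (β + 1 + j) ≠ 0 := (prod_pos fun _ _ => by positivity).ne'
    rw [h, Real.GammaSeq, prod_range_succ']
    have e : ∏ k ∈ range n, (β + ((k + 1 : ℕ) : ℝ)) = ∏ j ∈ range n, (β + 1 + j) :=
      prod_congr rfl fun k _ => by push_cast; ring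
    rw [e]
    push_cast
    field_simp
    simp

/-- The discretized Mittag-Leffler function. -/
noncomputable def discreteMittagLeffler (α : ℝ) (n : ℕ) (l : ℝ) : ℝ :=
  ∑' j : ℕ, (-l) ^ j * binomialNegCoeff (j * α + 1) n

theorem summable_one_add_pow_mul_geometric (n : ℕ) {r : ℝ} (hr : |r| < 1) :
    Summable fun j : ℕ => (1 + j : ℝ) ^ n * r ^ j := by
  simp_rw [add_comm (1 : ℝ), add_pow, one_pow, mul_one, sum_mul]
  refine summable_sum fun i _ => ?_
  refine ((summable_pow_mul_geometric_of_norm_lt_one i hr).mul_left (n.choose i : ℝ)).congr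
    fun j => by ring

theorem summable_discreteMittagLeffler {α : ℝ} (hα : 0 ≤ α) (hα1 : α ≤ 1) (n : ℕ) {l : ℝ}
    (hl : |l| < 1) : Summable fun j : ℕ => (-l) ^ j * binomialNegCoeff (j * α + 1) n := by
  refine (summable_one_add_pow_mul_geometric n (r := |l|) (by simpa using hl)).of_norm_bounded
    fun j => ?_
  have hj : (0 : ℝ) ≤ j * α := by positivity
  rw [norm_mul, norm_pow, norm_neg, Real.norm_eq_abs, Real.norm_eq_abs,
    abs_of_nonneg (binomialNegCoeff_nonneg (by linarith) n), mul_comm]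
  gcongr
  refine (binomialNegCoeff_le_pow hj n).trans ?_
  gcongr
  exact mul_le_of_le_one_right j.cast_nonneg hα1

theorem mk_discreteMittagLeffler_mul {α : ℝ} (hα : 0 ≤ α) (hα1 : α ≤ 1) {l : ℝ} (hl : |l| < 1) :
    PowerSeries.mk (discreteMittagLeffler α · l) *
      (binomialNegSeries (-α) + PowerSeries.C l) = binomialNegSeries (1 - α) := by
  have hs n := (summable_discreteMittagLeffler hα hα1 n hl)
  have hQ n : HasSum (fun j : ℕ => (-l) ^ j * binomialNegCoeff ((j - 1 : ℝ) * α + 1) n)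
      (PowerSeries.coeff n
        (PowerSeries.mk (discreteMittagLeffler α · l) * binomialNegSeries (-α))) := by
    rw [PowerSeries.coeff_mul]
    simp only [PowerSeries.coeff_mk, binomialNegSeries]
    refine (hasSum_sum fun p _ => ((hs p.1).hasSum.mul_right _)).congr_fun fun j => ?_
    have := congrArg (PowerSeries.coeff n) (binomialNegSeries_mul (j * α + 1) (-α))
    rw [PowerSeries.coeff_mul] at this
    simp only [PowerSeries.coeff_mk, binomialNegSeries] at this
    rw [show (j - 1 : ℝ) * α + 1 = j * α + 1 + -α by ring, ← this, mul_sum]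
    exact sum_congr rfl fun p _ => by ring
  ext n
  rw [mul_add, map_add, PowerSeries.coeff_mul_C, ← (hQ n).tsum_eq, (hQ n).summable.tsum_eq_zero_add]
  simp only [PowerSeries.coeff_mk, binomialNegSeries, discreteMittagLeffler]
  rw [add_assoc, ← tsum_mul_right, ← Summable.tsum_add
    ((summable_nat_add_iff 1).2 (hQ n).summable) ((hs n).mul_right l)]
  have e (j : ℕ) : (-l) ^ (j + 1) * binomialNegCoeff ((((j + 1 : ℕ) : ℝ) - 1) * α + 1) n
      + (-l) ^ j * binomialNegCoeff (j * α + 1) n * l = 0 := by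
    push_cast
    rw [add_sub_cancel_right]
    ring
  simp only [e, tsum_zero, add_zero]
  rw [show ((0 : ℕ) - 1 : ℝ) * α + 1 = 1 - α by push_cast; ring]
  simp

theorem discreteMittagLeffler_antitoneOn {α : ℝ} (hα : 0 ≤ α) (hα1 : α ≤ 1) (n : ℕ) :
    AntitoneOn (discreteMittagLeffler α n) (Set.Ico 0 1) := by
  intro l hl m hm hlm
  have pos {l : ℝ} (hl : 0 ≤ l) :
      0 < PowerSeries.coeff 0 (binomialNegSeries (-α) + PowerSeries.C l) := by
    simp only [map_add, binomialNegSeries, PowerSeries.coeff_mk, binomialNegCoeff_zero_right,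
      PowerSeries.coeff_zero_C]
    linarith
  have nonpos (l : ℝ) (k : ℕ) (hk : k ≠ 0) :
      PowerSeries.coeff k (binomialNegSeries (-α) + PowerSeries.C l) ≤ 0 := by
    simpa [binomialNegSeries, PowerSeries.coeff_C, hk] using binomialNegCoeff_neg_nonpos hα hα1 hk
  have key {l : ℝ} (hl : l ∈ Set.Ico (0 : ℝ) 1) :=
    mk_discreteMittagLeffler_mul hα hα1 (l := l) (by rw [abs_of_nonneg hl.1]; exact hl.2)
  have hnonneg k : 0 ≤ PowerSeries.coeff k (PowerSeries.mk (discreteMittagLeffler α · m)) := by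
    refine PowerSeries.coeff_nonneg_of_mul (pos hm.1) (nonpos m) (fun k => ?_) k
    rw [key hm, binomialNegSeries, PowerSeries.coeff_mk]
    exact binomialNegCoeff_nonneg (by linarith) k
  have hdiff := PowerSeries.coeff_nonneg_of_mul (pos hl.1) (nonpos l)
    (V := PowerSeries.mk (discreteMittagLeffler α · l) -
      PowerSeries.mk (discreteMittagLeffler α · m)) (fun k => ?_) n
  · simpa using hdiff
  · have e : (PowerSeries.mk (discreteMittagLeffler α · l) -
        PowerSeries.mk (discreteMittagLeffler α · m)) *
          (binomialNegSeries (-α) + PowerSeries.C l) =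
        PowerSeries.mk (discreteMittagLeffler α · m) * PowerSeries.C (m - l) := by
      rw [map_sub]
      linear_combination key hl - key hm
    rw [e, PowerSeries.coeff_mul_C]
    exact mul_nonneg (hnonneg k) (sub_nonneg.2 hlm)

theorem tendsto_discreteMittagLeffler {α : ℝ} (hα : 0 < α) (hα1 : α ≤ 1) {x : ℝ} (hx : 0 ≤ x) :
    Tendsto (fun n : ℕ => discreteMittagLeffler α n (x / (n : ℝ) ^ α)) atTop
      (𝓝 (mittagLeffler α (-x))) := by
  have hlim : Tendsto (fun n : ℕ => x / (n : ℝ) ^ α) atTop (𝓝 0) :=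
    tendsto_const_nhds.div_atTop ((tendsto_rpow_atTop hα).comp tendsto_natCast_atTop_atTop)
  obtain ⟨K, hK, hK0⟩ := ((hlim.eventually_lt_const one_pos).and (eventually_gt_atTop 0)).exists
  have hr : 0 ≤ x / (K : ℝ) ^ α := by positivity
  refine tendsto_tsum_of_dominated_convergence (bound := fun j : ℕ =>
    (1 + j : ℝ) ^ K * (x / (K : ℝ) ^ α) ^ j)
    (summable_one_add_pow_mul_geometric K (by rwa [abs_of_nonneg hr])) (fun j => ?_) ?_
  · have hj : (0 : ℝ) ≤ j * α := by positivity
    rw [div_eq_mul_inv]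
    refine ((tendsto_binomialNegCoeff_div_rpow hj).const_mul _).congr fun n => ?_
    rw [mul_comm (j : ℝ) α, Real.rpow_mul n.cast_nonneg, Real.rpow_natCast, ← neg_div, div_pow]
    ring
  · filter_upwards [eventually_ge_atTop K] with n hn j
    have hj : (0 : ℝ) ≤ j * α := by positivity
    have hn0 : (0 : ℝ) < n := by exact_mod_cast hK0.trans_le hn
    have hK0' : (0 : ℝ) < K := by exact_mod_cast hK0
    rw [norm_mul, norm_pow, norm_neg, Real.norm_of_nonneg (by positivity),
      Real.norm_of_nonneg (binomialNegCoeff_nonneg (by linarith) n)]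
    calc (x / (n : ℝ) ^ α) ^ j * binomialNegCoeff (j * α + 1) n
        ≤ (x / (n : ℝ) ^ α) ^ j * ((1 + j * α) ^ K * (n / K : ℝ) ^ (j * α)) := by
          gcongr
          exact binomialNegCoeff_le_rpow hj hK0 hn
      _ = (1 + j * α) ^ K * (x / (K : ℝ) ^ α) ^ j := by
          rw [mul_comm (j : ℝ) α, Real.rpow_mul (by positivity), Real.rpow_natCast,
            Real.div_rpow hn0.le hK0'.le, div_pow, div_pow, div_pow]
          field_simp
      _ ≤ _ := by
          gcongr
          exact mul_le_of_le_one_right j.cast_nonneg hα1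

theorem mittagLeffler_neg_antitoneOn {α : ℝ} (hα : 0 < α) (hα1 : α ≤ 1) :
    AntitoneOn (fun x => mittagLeffler α (-x)) (Set.Ici 0) := by
  intro x hx y hy hxy
  have hlim : Tendsto (fun n : ℕ => y / (n : ℝ) ^ α) atTop (𝓝 0) :=
    tendsto_const_nhds.div_atTop ((tendsto_rpow_atTop hα).comp tendsto_natCast_atTop_atTop)
  refine le_of_tendsto_of_tendsto (tendsto_discreteMittagLeffler hα hα1 hy)
    (tendsto_discreteMittagLeffler hα hα1 hx) ?_
  filter_upwards [hlim.eventually_lt_const one_pos] with n hn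
  have hle : x / (n : ℝ) ^ α ≤ y / (n : ℝ) ^ α := by gcongr
  exact discreteMittagLeffler_antitoneOn hα.le hα1 n
    ⟨div_nonneg hx (by positivity), hle.trans_lt hn⟩ ⟨div_nonneg hy (by positivity), hn⟩ hle

/-- For `0 < α ≤ 1` and `γ > 0`, the function `t ↦ E_α(-γ t^α)` is nonincreasing
on `[0,∞)`. -/
theorem mittagLeffler_comp_antitone (α γ : ℝ) (hα : 0 < α) (hα1 : α ≤ 1) (hγ : 0 < γ) :
    AntitoneOn (fun t : ℝ => mittagLeffler α (-γ * t ^ α)) (Set.Ici 0) := by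
  intro s hs t ht hst
  have hs' : (0 : ℝ) ≤ s := hs
  have ht' : (0 : ℝ) ≤ t := ht
  simp only [neg_mul]
  exact mittagLeffler_neg_antitoneOn hα hα1 (Set.mem_Ici.2 (by positivity))
    (Set.mem_Ici.2 (by positivity)) (by gcongr)
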